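/- arXiv:1905.00457 — 2 statements merged into one kernel-verified Lean document; each statement's English description precedes it below -/
import Mathlib

section
/- The independent markets mechanism satisfies reinforcement: for all preference profiles P (with n_P voters) and R (with n_R voters) such that A^IM_{n_P}(P) = A^IM_{n_R}(R), it holds that A^IM_{n_P + n_R}(P ∪ R) = A^IM_{n_P}(P), where P ∪ R denotes the concatenation of the two profiles and A^IM_k denotes the independent markets mechanism for k voters. -/
open Finset

/-- `p` is a budget division over `m` alternatives: entries in `[0,1]` summing to `1`. -/
def IsDivision {m : ℕ} (p : Fin m → ℝ) : Prop :=
  (∀ j, p j ∈ Set.Icc (0 : ℝ) 1) ∧ ∑ j, p j = 1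

/-- A valid preference profile: every voter reports a budget division. -/
def IsProfile {n m : ℕ} (P : Fin n → Fin m → ℝ) : Prop :=
  ∀ i, IsDivision (P i)

/-- The ℓ1 distance between two vectors. -/
noncomputable def l1 {m : ℕ} (x y : Fin m → ℝ) : ℝ := ∑ j, |x j - y j|

/-- Median of a list of odd length `2k+1`: its `(k+1)`-st smallest element. -/
noncomputable def medList (l : List ℝ) : ℝ :=
  ((Multiset.ofList l).sort (· ≤ ·)).getD ((l.length - 1) / 2) 0

/-- Coordinate-wise generalized median on alternative `j`, with phantoms `f k t` and
the voters' reports on alternative `j`. -/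
noncomputable def phMed {n m : ℕ} (f : Fin (n + 1) → ℝ → ℝ)
    (P : Fin n → Fin m → ℝ) (t : ℝ) (j : Fin m) : ℝ :=
  medList (List.ofFn (fun k => f k t) ++ List.ofFn (fun i => P i j))

/-- A phantom system for `n` voters: `n+1` continuous, weakly increasing functions
`[0,1] → [0,1]` with `f k 0 = 0`, `f k 1 = 1`, ordered `f 0 ≥ f 1 ≥ ⋯ ≥ f n`. -/
structure IsPhantomSystem (n : ℕ) (f : Fin (n + 1) → ℝ → ℝ) : Prop where
  cont : ∀ k, ContinuousOn (f k) (Set.Icc 0 1)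
  mono : ∀ k, MonotoneOn (f k) (Set.Icc 0 1)
  mem_Icc : ∀ k, ∀ t ∈ Set.Icc (0 : ℝ) 1, f k t ∈ Set.Icc (0 : ℝ) 1
  apply_zero : ∀ k, f k 0 = 0
  apply_one : ∀ k, f k 1 = 1
  ordered : ∀ t ∈ Set.Icc (0 : ℝ) 1, ∀ k l : Fin (n + 1), k ≤ l → f l t ≤ f k t

/-- The normalizing time `t*` at which the coordinate-wise medians sum to `1`. -/
noncomputable def tStar {n m : ℕ} (f : Fin (n + 1) → ℝ → ℝ)
    (P : Fin n → Fin m → ℝ) : ℝ :=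
  sInf {t | t ∈ Set.Icc (0 : ℝ) 1 ∧ ∑ j, phMed f P t j = 1}

/-- The moving phantom mechanism `A^F` defined by the phantom family `f`. -/
noncomputable def AMP {n m : ℕ} (f : Fin (n + 1) → ℝ → ℝ)
    (P : Fin n → Fin m → ℝ) : Fin m → ℝ :=
  fun j => phMed f P (tStar f P) j

/-- The independent-markets phantom system for `n` voters: `f k t = min (t(n-k)) 1`. -/
noncomputable def fIM (n : ℕ) : Fin (n + 1) → ℝ → ℝ :=
  fun k t => min (t * ((n : ℝ) - (k : ℝ))) 1

/-- The phantom system `F*` for `n` voters, in which the phantoms move to 1 one at a time. -/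
noncomputable def fStar (n : ℕ) : Fin (n + 1) → ℝ → ℝ :=
  fun k t => max 0 (min 1 (t * ((n : ℝ) + 1) - (k : ℝ)))

/-- The `j`-th standard unit vector in `ℝ^m`. -/
def unitVec (m : ℕ) (j : Fin m) : Fin m → ℝ := fun k => if k = j then 1 else 0

/-- Incentive compatibility under ℓ1 preferences. -/
def IncentiveCompatible {n m : ℕ} (A : (Fin n → Fin m → ℝ) → (Fin m → ℝ)) : Prop :=
  ∀ P : Fin n → Fin m → ℝ, IsProfile P → ∀ i : Fin n,
    ∀ ptrue pmis : Fin m → ℝ, IsDivision ptrue → IsDivision pmis →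
      l1 (A (Function.update P i ptrue)) ptrue ≤ l1 (A (Function.update P i pmis)) ptrue

/-- Anonymity: the output is invariant under permutations of the voters. -/
def Anonymous {n m : ℕ} (A : (Fin n → Fin m → ℝ) → (Fin m → ℝ)) : Prop :=
  ∀ P : Fin n → Fin m → ℝ, IsProfile P → ∀ σ : Equiv.Perm (Fin n), A (P ∘ σ) = A P

/-- Neutrality: permuting the alternatives in all reports permutes the output likewise. -/
def Neutral {n m : ℕ} (A : (Fin n → Fin m → ℝ) → (Fin m → ℝ)) : Prop :=
  ∀ P : Fin n → Fin m → ℝ, IsProfile P → ∀ σ : Equiv.Perm (Fin m),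
    A (fun i j => P i (σ j)) = fun j => A P (σ j)

/-- Proportionality: on single-minded profiles, alternative `j` gets `n_j / n`. -/
def Proportional {n m : ℕ} (A : (Fin n → Fin m → ℝ) → (Fin m → ℝ)) : Prop :=
  ∀ P : Fin n → Fin m → ℝ, (∀ i, ∃ j, P i = unitVec m j) →
    ∀ j, A P j = (Nat.card {i : Fin n // P i = unitVec m j} : ℝ) / (n : ℝ)

/-- Pareto optimality. -/
def ParetoOptimal {n m : ℕ} (A : (Fin n → Fin m → ℝ) → (Fin m → ℝ)) : Prop :=
  ∀ P : Fin n → Fin m → ℝ, IsProfile P → ∀ q : Fin m → ℝ, IsDivision q →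
    (∃ i, l1 q (P i) < l1 (A P) (P i)) → ∃ i, l1 (A P) (P i) < l1 q (P i)

/-- A mechanism is valid if it maps profiles to budget divisions. -/
def ValidMech {n m : ℕ} (A : (Fin n → Fin m → ℝ) → (Fin m → ℝ)) : Prop :=
  ∀ P, IsProfile P → IsDivision (A P)

/-- `q` maximizes (utilitarian) social welfare for `P`, i.e. minimizes total ℓ1 distance. -/
def MaximizesWelfare {n m : ℕ} (P : Fin n → Fin m → ℝ) (q : Fin m → ℝ) : Prop :=
  IsDivision q ∧ ∀ q' : Fin m → ℝ, IsDivision q' → ∑ i, l1 (P i) q ≤ ∑ i, l1 (P i) q'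

/-- The `k`-th largest entry of `v` (1-indexed); `0` when `k > n`. -/
noncomputable def kthLargest {n : ℕ} (v : Fin n → ℝ) (k : ℕ) : ℝ :=
  (((Multiset.ofList (List.ofFn v)).sort (· ≤ ·)).reverse).getD (k - 1) 0

open Classical in
/-- number of entries satisfying `p` -/
noncomputable def cnt {n : ℕ} (p : ℝ → Prop) (v : Fin n → ℝ) : ℕ :=
  ∑ i, if p (v i) then 1 else 0

open Classical in
lemma countP_ofFn_cnt {n : ℕ} (p : ℝ → Prop) (v : Fin n → ℝ) :
    (List.ofFn v).countP (fun x => decide (p x)) = cnt p v := by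
  induction n with
  | zero => simp [cnt]
  | succ n ih =>
    rw [List.ofFn_succ, List.countP_cons, ih]
    simp only [cnt]
    rw [Fin.sum_univ_succ, add_comm]
    simp

lemma cnt_le {n : ℕ} (p : ℝ → Prop) (v : Fin n → ℝ) : cnt p v ≤ n := by
  classical
  unfold cnt
  calc _ ≤ ∑ i : Fin n, 1 := Finset.sum_le_sum (fun i _ => by split_ifs <;> simp)
    _ = n := by simp

lemma cnt_mono {n : ℕ} {p q : ℝ → Prop} (h : ∀ x, p x → q x) (v : Fin n → ℝ) :
    cnt p v ≤ cnt q v := by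
  classical
  unfold cnt
  refine Finset.sum_le_sum (fun i _ => ?_)
  by_cases hp : p (v i)
  · simp [hp, h _ hp]
  · simp [hp]

lemma cnt_append {a b m : ℕ} (p : ℝ → Prop) (P : Fin a → Fin m → ℝ) (R : Fin b → Fin m → ℝ)
    (j : Fin m) : cnt p (fun i => Fin.append P R i j) =
      cnt p (fun i => P i j) + cnt p (fun i => R i j) := by
  unfold cnt
  rw [Fin.sum_univ_add]
  have hl : ∀ x, Fin.append P R (Fin.castAdd b x) j = P x j := fun x => by rw [Fin.append_left]
  have hr : ∀ x, Fin.append P R (Fin.natAdd a x) j = R x j := fun x => by rw [Fin.append_right]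
  congr 1
  · exact Finset.sum_congr rfl (fun x _ => by beta_reduce; rw [hl])
  · exact Finset.sum_congr rfl (fun x _ => by beta_reduce; rw [hr])

lemma cnt_pos {n : ℕ} (p : ℝ → Prop) (v : Fin n → ℝ) (i : Fin n) (h : p (v i)) :
    1 ≤ cnt p v := by
  classical
  unfold cnt
  have := Finset.single_le_sum (f := fun i => if p (v i) then 1 else 0) (s := Finset.univ)
    (fun i _ => Nat.zero_le _) (Finset.mem_univ i)
  simpa [h] using this

lemma cnt_zero {n : ℕ} (p : ℝ → Prop) (v : Fin n → ℝ) (h : ∀ i, ¬ p (v i)) :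
    cnt p v = 0 := by
  simp [cnt, h]

open Classical in
lemma sorted_get (p : ℝ → Prop) (hp : ∀ x y, x ≤ y → p x → p y) (s : List ℝ)
    (hs : s.Pairwise (· ≤ ·)) (k : ℕ) (hl : s.length = 2 * k + 1) :
    p (s.getD k 0) ↔ k + 1 ≤ s.countP (fun x => decide (p x)) := by
  have hk : k < s.length := by omega
  rw [List.getD_eq_getElem _ _ hk]
  rw [List.pairwise_iff_getElem] at hs
  have hmono : ∀ i j (hi : i < s.length) (hj : j < s.length), i ≤ j → s[i] ≤ s[j] := by
    intro i j hi hj hij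
    rcases hij.eq_or_lt with h | h
    · subst h; exact le_rfl
    · exact hs i j hi hj h
  constructor
  · intro h
    have h1 : (s.drop k).countP (fun x => decide (p x)) = (s.drop k).length := by
      rw [List.countP_eq_length]
      intro a ha
      obtain ⟨i, hi, rfl⟩ := List.mem_iff_getElem.1 ha
      rw [List.getElem_drop]
      simp only [decide_eq_true_eq]
      exact hp _ _ (hmono _ _ _ _ (by omega)) h
    have h2 := (List.drop_sublist k s).countP_le (p := fun x => decide (p x))
    rw [h1, List.length_drop] at h2
    omega
  · intro h
    by_contra hn
    have h1 : (s.take (k+1)).countP (fun x => decide (p x)) = 0 := by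
      rw [List.countP_eq_zero]
      intro a ha
      obtain ⟨i, hi, rfl⟩ := List.mem_iff_getElem.1 ha
      rw [List.getElem_take]
      simp only [decide_eq_true_eq]
      rw [List.length_take] at hi
      exact fun hc => hn (hp _ _ (hmono _ _ _ _ (by omega)) hc)
    have h2 := List.countP_append (p := fun x => decide (p x)) (l₁ := s.take (k+1))
      (l₂ := s.drop (k+1))
    rw [List.take_append_drop, h1] at h2
    have h3 := List.countP_le_length (p := fun x => decide (p x)) (l := s.drop (k+1))
    rw [List.length_drop] at h3
    omega

open Classical in
lemma medList_iff (p : ℝ → Prop) (hp : ∀ x y, x ≤ y → p x → p y) (l : List ℝ)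
    (k : ℕ) (hl : l.length = 2 * k + 1) :
    p (medList l) ↔ k + 1 ≤ l.countP (fun x => decide (p x)) := by
  have hperm : ((Multiset.ofList l).sort (· ≤ ·)).Perm l := by
    rw [← Multiset.coe_eq_coe, Multiset.sort_eq]
  unfold medList
  rw [hl, show (2 * k + 1 - 1) / 2 = k by omega,
    sorted_get p hp _ (Multiset.pairwise_sort _ _) k (by rw [hperm.length_eq, hl]),
    hperm.countP_eq]

lemma cnt_desc {n : ℕ} (p : ℝ → Prop) (hp : ∀ x y, x ≤ y → p x → p y) (g : Fin (n + 1) → ℝ)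
    (hg : ∀ i j, i ≤ j → g j ≤ g i) (c : Fin (n + 1)) :
    p (g c) ↔ (c : ℕ) + 1 ≤ cnt p g := by
  classical
  have hc : cnt p g = (Finset.univ.filter (fun i => p (g i))).card := by
    simp [cnt, Finset.sum_boole]
  rw [hc]
  constructor
  · intro h
    rw [← Fin.card_Iic]
    refine Finset.card_le_card (fun i hi => ?_)
    simp only [Finset.mem_Iic] at hi
    simpa using hp _ _ (hg _ _ hi) h
  · intro h
    by_contra hn
    have : (Finset.univ.filter (fun i => p (g i))).card ≤ (Finset.Iio c).card := by
      refine Finset.card_le_card (fun i hi => ?_)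
      simp only [Finset.mem_filter, Finset.mem_univ, true_and] at hi
      simp only [Finset.mem_Iio]
      by_contra hlt
      exact hn (hp _ _ (hg _ _ (not_lt.1 hlt)) hi)
    rw [Fin.card_Iio] at this
    omega

lemma phMed_iff {n m : ℕ} (p : ℝ → Prop) (hp : ∀ x y, x ≤ y → p x → p y)
    (P : Fin n → Fin m → ℝ) (t : ℝ) (ht : 0 ≤ t) (j : Fin m) :
    p (phMed (fIM n) P t j) ↔ p (min (t * (cnt p (fun i => P i j) : ℝ)) 1) := by
  unfold phMed
  rw [medList_iff p hp _ n (by simp; omega), List.countP_append, countP_ofFn_cnt,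
    countP_ofFn_cnt]
  have hle := cnt_le p (fun i => P i j)
  set c := cnt p (fun i => P i j) with hc
  have hg : ∀ i k : Fin (n + 1), i ≤ k → fIM n k t ≤ fIM n i t := by
    intro i k hik
    unfold fIM
    have : ((i : ℕ) : ℝ) ≤ ((k : ℕ) : ℝ) := by exact_mod_cast hik
    gcongr
  have h := cnt_desc p hp (fun k => fIM n k t) hg ⟨n - c, by omega⟩
  have e : fIM n ⟨n - c, by omega⟩ t = min (t * (c : ℝ)) 1 := by
    simp only [fIM]
    rw [Nat.cast_sub hle]
    ring_nf
  simp only [e] at h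
  rw [h]
  omega

lemma lt_phMed {n m : ℕ} (P : Fin n → Fin m → ℝ) (hP : IsProfile P) (t : ℝ) (ht : 0 ≤ t)
    (j : Fin m) (x : ℝ) (hx : 0 ≤ x) :
    x < phMed (fIM n) P t j ↔ x < t * (cnt (fun y => x < y) (fun i => P i j) : ℝ) := by
  rw [phMed_iff (fun y => x < y) (fun a b h h' => lt_of_lt_of_le h' h) P t ht j, lt_min_iff]
  refine ⟨fun h => h.1, fun h => ⟨h, ?_⟩⟩
  by_contra h1
  rw [cnt_zero _ _ (fun i => not_lt.2 (((hP i).1 j).2.trans (not_lt.1 h1)))] at h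
  simp at h
  linarith

lemma le_phMed {n m : ℕ} (P : Fin n → Fin m → ℝ) (hP : IsProfile P) (t : ℝ) (ht : 0 ≤ t)
    (j : Fin m) (x : ℝ) (hx : 0 ≤ x) :
    x ≤ phMed (fIM n) P t j ↔ x ≤ t * (cnt (fun y => x ≤ y) (fun i => P i j) : ℝ) := by
  rw [phMed_iff (fun y => x ≤ y) (fun a b h h' => le_trans h' h) P t ht j, le_min_iff]
  refine ⟨fun h => h.1, fun h => ⟨h, ?_⟩⟩
  by_contra h1
  rw [cnt_zero _ _ (fun i => not_le.2 (((hP i).1 j).2.trans_lt (not_le.1 h1)))] at h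
  simp at h
  linarith

lemma phMed_nonneg {n m : ℕ} (P : Fin n → Fin m → ℝ) (hP : IsProfile P) (t : ℝ) (ht : 0 ≤ t)
    (j : Fin m) : 0 ≤ phMed (fIM n) P t j := by
  rw [le_phMed P hP t ht j 0 le_rfl]
  positivity

lemma phMed_mono {n m : ℕ} (P : Fin n → Fin m → ℝ) (hP : IsProfile P) (t s : ℝ) (ht : 0 ≤ t)
    (hs : t ≤ s) (j : Fin m) : phMed (fIM n) P t j ≤ phMed (fIM n) P s j := by
  have h0 := phMed_nonneg P hP t ht j
  rw [le_phMed P hP s (ht.trans hs) j _ h0]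
  refine ((le_phMed P hP t ht j _ h0).1 le_rfl).trans ?_
  gcongr

lemma phMed_lip {n m : ℕ} (P : Fin n → Fin m → ℝ) (hP : IsProfile P) (t s : ℝ) (ht : 0 ≤ t)
    (hs : t ≤ s) (j : Fin m) :
    phMed (fIM n) P s j ≤ phMed (fIM n) P t j + n * (s - t) := by
  have h0 := phMed_nonneg P hP t ht j
  set y := phMed (fIM n) P t j with hy
  have hd : 0 ≤ s - t := by linarith
  have hd' : (0:ℝ) ≤ n * (s - t) := by positivity
  by_contra hlt
  rw [not_le, lt_phMed P hP s (ht.trans hs) j _ (by linarith)] at hlt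
  have h1 : ¬ y < phMed (fIM n) P t j := by simp [hy]
  rw [lt_phMed P hP t ht j _ h0] at h1
  have h2 : (cnt (fun z => y + n * (s - t) < z) (fun i => P i j) : ℝ) ≤
      cnt (fun z => y < z) (fun i => P i j) := by
    exact_mod_cast cnt_mono (fun x hx => by linarith) _
  have h3 : (cnt (fun z => y < z) (fun i => P i j) : ℝ) ≤ n := by
    exact_mod_cast cnt_le _ _
  have hs0 : 0 ≤ s := ht.trans hs
  nlinarith [mul_le_mul_of_nonneg_left h2 hs0, mul_le_mul_of_nonneg_left h3 hd]

lemma phMed_cont {n m : ℕ} (P : Fin n → Fin m → ℝ) (hP : IsProfile P) (j : Fin m) :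
    ContinuousOn (fun t => phMed (fIM n) P t j) (Set.Icc 0 1) := by
  have : LipschitzOnWith n (fun t => phMed (fIM n) P t j) (Set.Icc 0 1) := by
    refine LipschitzOnWith.of_le_add_mul _ (fun x hx y hy => ?_)
    rw [Real.dist_eq]
    simp only [NNReal.coe_natCast]
    rcases le_total x y with h | h
    · have := phMed_mono P hP x y hx.1 h j
      have : (0:ℝ) ≤ n * |x - y| := by positivity
      linarith
    · rw [abs_of_nonneg (by linarith)]
      exact phMed_lip P hP y x hy.1 h j
  exact this.continuousOn

lemma tStar_spec {n m : ℕ} (hn : 1 ≤ n) (P : Fin n → Fin m → ℝ) (hP : IsProfile P) :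
    tStar (fIM n) P ∈ {t | t ∈ Set.Icc (0 : ℝ) 1 ∧ ∑ j, phMed (fIM n) P t j = 1} := by
  have hc : ContinuousOn (fun t => ∑ j, phMed (fIM n) P t j) (Set.Icc 0 1) :=
    continuousOn_finsetSum _ (fun j _ => phMed_cont P hP j)
  have h0 : ∑ j, phMed (fIM n) P 0 j ≤ 1 := by
    refine (Finset.sum_nonpos (fun j _ => ?_)).trans zero_le_one
    by_contra h
    rw [not_le, lt_phMed P hP 0 le_rfl j 0 le_rfl] at h
    simp at h
  have h1 : 1 ≤ ∑ j, phMed (fIM n) P 1 j := by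
    refine (hP ⟨0, hn⟩).2.ge.trans ?_
    refine Finset.sum_le_sum (fun j _ => ?_)
    have hd := (hP ⟨0, hn⟩).1 j
    rw [le_phMed P hP 1 zero_le_one j _ hd.1]
    have : 1 ≤ cnt (fun y => P ⟨0, hn⟩ j ≤ y) (fun i => P i j) := cnt_pos _ _ ⟨0, hn⟩ le_rfl
    have : (1:ℝ) ≤ cnt (fun y => P ⟨0, hn⟩ j ≤ y) (fun i => P i j) := by exact_mod_cast this
    linarith [hd.2]
  refine IsClosed.csInf_mem ?_ ?_ ⟨0, fun t ht => ht.1.1⟩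
  · exact hc.preimage_isClosed_of_isClosed isClosed_Icc isClosed_singleton
  · obtain ⟨t, ht, h⟩ := intermediate_value_Icc zero_le_one hc ⟨h0, h1⟩
    exact ⟨t, ht, h⟩

lemma AMP_unique {n m : ℕ} (hn : 1 ≤ n) (P : Fin n → Fin m → ℝ) (hP : IsProfile P) (u : ℝ)
    (hu : u ∈ Set.Icc (0 : ℝ) 1) (hs : ∑ j, phMed (fIM n) P u j = 1) (j : Fin m) :
    AMP (fIM n) P j = phMed (fIM n) P u j := by
  have ht := tStar_spec hn P hP
  have hle : tStar (fIM n) P ≤ u := csInf_le ⟨0, fun t ht => ht.1.1⟩ ⟨hu, hs⟩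
  exact (Finset.sum_eq_sum_iff_of_le
    (fun j _ => phMed_mono P hP _ u ht.1.1 hle j)).1 (ht.2.trans hs.symm) j (Finset.mem_univ j)

lemma tStar_pos {n m : ℕ} (hn : 1 ≤ n) (P : Fin n → Fin m → ℝ) (hP : IsProfile P) :
    0 < tStar (fIM n) P := by
  have ht := tStar_spec hn P hP
  refine lt_of_le_of_ne ht.1.1 (fun h => ?_)
  have h2 := ht.2
  rw [← h] at h2
  have : ∑ j, phMed (fIM n) P 0 j ≤ 0 := by
    refine Finset.sum_nonpos (fun j _ => ?_)
    by_contra h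
    rw [not_le, lt_phMed P hP 0 le_rfl j 0 le_rfl] at h
    simp at h
  linarith

/-- the independent markets mechanism satisfies reinforcement. -/
theorem im_reinforcement (m : ℕ) (hm : 2 ≤ m) (nP nR : ℕ) (hnP : 1 ≤ nP) (hnR : 1 ≤ nR)
    (P : Fin nP → Fin m → ℝ) (hP : IsProfile P)
    (R : Fin nR → Fin m → ℝ) (hR : IsProfile R)
    (heq : AMP (fIM nP) P = AMP (fIM nR) R) :
    AMP (fIM (nP + nR)) (Fin.append P R) = AMP (fIM nP) P := by
  have hQ : IsProfile (Fin.append P R) := by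
    intro i
    refine Fin.addCases (fun i => ?_) (fun i => ?_) i
    · rw [Fin.append_left]; exact hP i
    · rw [Fin.append_right]; exact hR i
  have sP := tStar_spec hnP P hP
  have sR := tStar_spec hnR R hR
  have pP := tStar_pos hnP P hP
  have pR := tStar_pos hnR R hR
  have heq' : ∀ j, phMed (fIM nR) R (tStar (fIM nR) R) j =
      phMed (fIM nP) P (tStar (fIM nP) P) j := fun j => (congrFun heq j).symm
  have key : ∀ j, AMP (fIM nP) P j = phMed (fIM nP) P (tStar (fIM nP) P) j := fun j => rfl
  generalize tStar (fIM nP) P = t at *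
  generalize tStar (fIM nR) R = s at *
  have hu0 : 0 < t * s / (t + s) := by positivity
  have hu1 : t * s / (t + s) ≤ 1 := by
    rw [div_le_one (by positivity)]
    nlinarith [sR.1.2]
  have hmed : ∀ j, phMed (fIM (nP + nR)) (Fin.append P R) (t * s / (t + s)) j =
      phMed (fIM nP) P t j := by
    intro j
    have h0 := phMed_nonneg P hP t pP.le j
    have hx := heq' j

    have a1 := (le_phMed P hP t pP.le j _ h0).1 le_rfl
    have a2 := (lt_phMed P hP t pP.le j _ h0).not.1 (lt_irrefl _)
    have b1 := (le_phMed R hR s pR.le j _ h0).1 hx.ge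
    have b2 := (lt_phMed R hR s pR.le j _ h0).not.1 hx.le.not_gt
    have hts : 0 < t + s := by positivity
    apply le_antisymm
    · by_contra hc
      rw [not_le, lt_phMed _ hQ _ hu0.le j _ h0, cnt_append, div_mul_eq_mul_div,
        lt_div_iff₀ hts] at hc
      push_cast at hc
      rw [not_lt] at a2 b2
      nlinarith [mul_le_mul_of_nonneg_left a2 pR.le, mul_le_mul_of_nonneg_left b2 pP.le]
    · rw [le_phMed _ hQ _ hu0.le j _ h0, cnt_append, div_mul_eq_mul_div, le_div_iff₀ hts]
      push_cast
      nlinarith [mul_le_mul_of_nonneg_left a1 pR.le, mul_le_mul_of_nonneg_left b1 pP.le]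
  funext j
  rw [AMP_unique (by omega) _ hQ _ ⟨hu0.le, hu1⟩ _ j, hmed, key]
  rw [← sP.2]
  exact Finset.sum_congr rfl (fun j _ => hmed j)
end

section
/- Under the independent markets mechanism, adding a new voter who reports the current aggregate does not change the aggregate: for every integer n ≥ 2 and every (n−1)-voter preference profile P_{-i}, A^IM_n(A^IM_{n−1}(P_{-i}), P_{-i}) = A^IM_{n−1}(P_{-i}), where A^IM_k denotes the independent markets mechanism for k voters and (q, P_{-i}) denotes the n-voter profile obtained by adjoining report q to P_{-i}. -/
open Finset

theorem aux_sorted (p : ℝ → Prop) [DecidablePred p] (hp : ∀ x y, x ≤ y → p y → p x) (l : List ℝ)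
    (hl : l.Pairwise (· ≤ ·)) (i : ℕ) (hi : i < l.length) :
    p (l.getD i 0) ↔ i + 1 ≤ l.countP (fun x => decide (p x)) := by
  induction l generalizing i with
  | nil => simp at hi
  | cons a l ih =>
    rw [List.pairwise_cons] at hl
    by_cases ha : p a
    · rw [List.countP_cons_of_pos (by simpa using ha)]
      cases i with
      | zero => simpa using ha
      | succ i =>
        rw [List.getD_cons_succ, ih hl.2 i (by simpa using hi)]
        omega
    · have h0 : ∀ x ∈ a :: l, ¬ p x := by
        intro x hx
        rcases List.mem_cons.1 hx with rfl | hx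
        · exact ha
        · exact fun h => ha (hp _ _ (hl.1 x hx) h)
      have h1 : (a :: l).countP (fun x => decide (p x)) = 0 := by
        rw [List.countP_eq_zero]
        simpa using h0
      rw [h1, List.getD_eq_getElem _ _ hi]
      simp only [Nat.le_zero, Nat.add_eq_zero_iff, one_ne_zero, and_false, iff_false]
      exact h0 _ (List.getElem_mem _)

theorem aux_med (p : ℝ → Prop) [DecidablePred p] (hp : ∀ x y, x ≤ y → p y → p x) (l : List ℝ)
    (n : ℕ) (hn : l.length = 2 * n + 1) :
    p (medList l) ↔ n + 1 ≤ l.countP (fun x => decide (p x)) := by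
  unfold medList
  have h1 : (l.length - 1) / 2 = n := by omega
  rw [h1, aux_sorted p hp _ (Multiset.pairwise_sort _ _) n (by rw [Multiset.length_sort, Multiset.coe_card]; omega)]
  have h2 : ((Multiset.ofList l).sort (· ≤ ·)).Perm l := by
    rw [← Multiset.coe_eq_coe, Multiset.sort_eq]
  rw [h2.countP_eq]

theorem aux_ofFn (p : ℝ → Prop) [DecidablePred p] (n : ℕ) (f : Fin n → ℝ) :
    (List.ofFn f).countP (fun x => decide (p x)) = (univ.filter (fun i => p (f i))).card := by
  induction n with
  | zero => simp
  | succ n ih =>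
    rw [List.ofFn_succ, List.countP_cons, ih, Fin.card_filter_univ_succ]
    by_cases h : p (f 0) <;> simp [h]

theorem aux_ph (p : ℝ → Prop) [DecidablePred p] (hp : ∀ x y, x ≤ y → p y → p x) {n m : ℕ}
    (f : Fin (n + 1) → ℝ → ℝ) (P : Fin n → Fin m → ℝ) (t : ℝ) (j : Fin m) :
    p (phMed f P t j) ↔ n + 1 ≤ (univ.filter (fun k => p (f k t))).card
      + (univ.filter (fun i => p (P i j))).card := by
  unfold phMed
  rw [aux_med p hp _ n (by simp; omega), List.countP_append, aux_ofFn, aux_ofFn]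

theorem aux_le {n m : ℕ} (f : Fin (n + 1) → ℝ → ℝ) (P : Fin n → Fin m → ℝ) (t : ℝ) (j : Fin m)
    (x : ℝ) : phMed f P t j ≤ x ↔ n + 1 ≤ (univ.filter (fun k => f k t ≤ x)).card
      + (univ.filter (fun i => P i j ≤ x)).card :=
  aux_ph (· ≤ x) (fun _ _ h h' => h.trans h') f P t j

theorem aux_lt {n m : ℕ} (f : Fin (n + 1) → ℝ → ℝ) (P : Fin n → Fin m → ℝ) (t : ℝ) (j : Fin m)
    (x : ℝ) : phMed f P t j < x ↔ n + 1 ≤ (univ.filter (fun k => f k t < x)).card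
      + (univ.filter (fun i => P i j < x)).card :=
  aux_ph (· < x) (fun _ _ h h' => h.trans_lt h') f P t j

theorem aux_shift {n m : ℕ} (f : Fin (n + 1) → ℝ → ℝ) (P : Fin n → Fin m → ℝ) (s t e : ℝ)
    (he : 0 ≤ e) (h : ∀ k, f k s ≤ f k t + e) (j : Fin m) :
    phMed f P s j ≤ phMed f P t j + e := by
  rw [aux_le]
  refine ((aux_le f P t j _).1 le_rfl).trans (Nat.add_le_add ?_ ?_)
  · apply Finset.card_le_card
    intro k hk
    simp only [mem_filter, mem_univ, true_and] at hk ⊢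
    linarith [h k]
  · apply Finset.card_le_card
    intro k hk
    simp only [mem_filter, mem_univ, true_and] at hk ⊢
    linarith

theorem aux_mono {n m : ℕ} (P : Fin n → Fin m → ℝ) (s t : ℝ) (hst : s ≤ t) (j : Fin m) :
    phMed (fIM n) P s j ≤ phMed (fIM n) P t j := by
  have := aux_shift (fIM n) P s t 0 le_rfl (fun k => by
    have hk : ((k : ℕ) : ℝ) ≤ n := by exact_mod_cast Nat.lt_succ_iff.1 k.2
    simp only [fIM, add_zero]
    exact min_le_min_right _ (mul_le_mul_of_nonneg_right hst (by linarith))) j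
  simpa using this

theorem aux_cont {n m : ℕ} (P : Fin n → Fin m → ℝ) (j : Fin m) :
    Continuous (fun t => phMed (fIM n) P t j) := by
  have : LipschitzWith (n : NNReal) (fun t => phMed (fIM n) P t j) := by
    apply LipschitzWith.of_le_add_mul
    intro s t
    apply aux_shift
    · positivity
    · intro k
      have hk : ((k : ℕ) : ℝ) ≤ n := by exact_mod_cast Nat.lt_succ_iff.1 k.2
      have hk0 : (0 : ℝ) ≤ ((k : ℕ) : ℝ) := by positivity
      have hd : 0 ≤ dist s t := dist_nonneg
      have hst : s - t ≤ dist s t := le_abs_self _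
      simp only [fIM, NNReal.coe_natCast]
      have h1 : s * ((n : ℝ) - k) ≤ t * ((n : ℝ) - k) + n * dist s t := by nlinarith
      have h2 : 0 ≤ n * dist s t := by positivity
      rw [← min_add_add_right]
      exact le_min ((min_le_left _ _).trans h1) ((min_le_right _ _).trans (by linarith))
  exact this.continuous

theorem aux_tStar {n m : ℕ} (P : Fin n → Fin m → ℝ)
    (h : ∃ t, t ∈ Set.Icc (0 : ℝ) 1 ∧ ∑ j, phMed (fIM n) P t j = 1) :
    tStar (fIM n) P ∈ Set.Icc (0 : ℝ) 1 ∧ ∑ j, phMed (fIM n) P (tStar (fIM n) P) j = 1 := by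
  have hc : IsClosed {t | t ∈ Set.Icc (0 : ℝ) 1 ∧ ∑ j, phMed (fIM n) P t j = 1} :=
    isClosed_Icc.inter (isClosed_eq (continuous_finsetSum _ fun j _ => aux_cont P j)
      continuous_const)
  exact hc.csInf_mem h ⟨0, fun t ht => ht.1.1⟩

theorem aux_exists {n m : ℕ} (hn : 1 ≤ n) (P : Fin n → Fin m → ℝ) (hP : IsProfile P) :
    ∃ t, t ∈ Set.Icc (0 : ℝ) 1 ∧ ∑ j, phMed (fIM n) P t j = 1 := by
  have hc : Continuous (fun t => ∑ j, phMed (fIM n) P t j) :=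
    continuous_finsetSum _ fun j _ => aux_cont P j
  have h0 : ∑ j, phMed (fIM n) P 0 j ≤ 1 := by
    have : ∑ j, phMed (fIM n) P 0 j ≤ ∑ j : Fin m, (0 : ℝ) := by
      apply Finset.sum_le_sum
      intro j _
      rw [aux_le]
      simp [fIM]
    simp at this
    linarith
  have h1 : 1 ≤ ∑ j, phMed (fIM n) P 1 j := by
    refine (hP ⟨0, hn⟩).2.symm.le.trans ?_
    apply Finset.sum_le_sum
    intro j _
    rw [← not_lt, aux_lt, not_le]
    have hx := ((hP ⟨0, hn⟩).1 j)
    have ha : (univ.filter (fun k => fIM n k 1 < P ⟨0, hn⟩ j)).card ≤ 1 := by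
      refine (Finset.card_le_card (t := {Fin.last n}) ?_).trans (by simp)
      intro k hk
      simp only [mem_filter, mem_univ, true_and, fIM, one_mul] at hk
      rw [mem_singleton]
      by_contra hne
      have hlt : (k : ℕ) < n := by
        have := Fin.lt_last_iff_ne_last.2 hne
        exact this
      have hlt' : ((k : ℕ) : ℝ) + 1 ≤ n := by exact_mod_cast hlt
      have := hx.2
      rw [min_eq_right (by linarith)] at hk
      linarith
    have hb : (univ.filter (fun i => P i j < P ⟨0, hn⟩ j)).card < n := by
      have : (univ.filter (fun i => P i j < P ⟨0, hn⟩ j)).card < (univ : Finset (Fin n)).card := by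
        apply Finset.card_lt_card
        rw [Finset.filter_ssubset]
        exact ⟨⟨0, hn⟩, mem_univ _, lt_irrefl _⟩
      simpa using this
    omega
  obtain ⟨t, ht, h⟩ := intermediate_value_Icc (zero_le_one' ℝ) hc.continuousOn ⟨h0, h1⟩
  exact ⟨t, ht, h⟩

theorem aux_same {k m : ℕ} (P : Fin k → Fin m → ℝ) (t : ℝ) (ht : 0 ≤ t) (q : Fin m → ℝ)
    (j : Fin m) (hq : q j = phMed (fIM k) P t j) :
    phMed (fIM (k + 1)) (Fin.cons q P : Fin (k + 1) → Fin m → ℝ) t j = q j := by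
  have hs : ∀ i : Fin (k + 1), fIM (k + 1) i.succ t = fIM k i t := by
    intro i
    simp [fIM]
  have hmax : q j ≤ fIM (k + 1) 0 t := by
    rw [hq, aux_le]
    have : univ.filter (fun i => fIM k i t ≤ fIM (k + 1) 0 t) = univ := by
      rw [Finset.filter_eq_self]
      intro i _
      simp only [fIM]
      apply min_le_min_right
      apply mul_le_mul_of_nonneg_left _ ht
      have hk0 : (0 : ℝ) ≤ ((i : ℕ) : ℝ) := by positivity
      push_cast
      simp
      linarith
    rw [this]
    simp
  apply le_antisymm
  · have h := (aux_le (fIM k) P t j (q j)).1 hq.ge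
    rw [aux_le, Fin.card_filter_univ_succ (fun i => fIM (k + 1) i t ≤ q j),
      Fin.card_filter_univ_succ (fun i => (Fin.cons q P : Fin (k + 1) → Fin m → ℝ) i j ≤ q j)]
    simp only [Function.comp_def, hs, Fin.cons_zero, Fin.cons_succ, le_refl, if_true]
    split_ifs <;> omega
  · have h := (aux_lt (fIM k) P t j (q j)).not.1 (not_lt.2 hq.le)
    rw [← not_lt, aux_lt, Fin.card_filter_univ_succ (fun i => fIM (k + 1) i t < q j),
      Fin.card_filter_univ_succ (fun i => (Fin.cons q P : Fin (k + 1) → Fin m → ℝ) i j < q j)]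
    simp only [Function.comp_def, hs, Fin.cons_zero, Fin.cons_succ, lt_irrefl, if_false,
      not_lt.2 hmax]
    omega

/-- under independent markets, adding a new voter who reports the current
aggregate does not change the aggregate. -/
theorem im_add_agreeing_voter (m k : ℕ) (hm : 2 ≤ m) (hk : 1 ≤ k)
    (P : Fin k → Fin m → ℝ) (hP : IsProfile P) :
    AMP (fIM (k + 1)) (Fin.cons (AMP (fIM k) P) P) = AMP (fIM k) P := by
  obtain ⟨ht, hsum⟩ := aux_tStar P (aux_exists hk P hP)
  set t := tStar (fIM k) P with htdef
  set q := AMP (fIM k) P with hqdef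
  have hq : ∀ j, phMed (fIM (k + 1)) (Fin.cons q P : Fin (k + 1) → Fin m → ℝ) t j = q j :=
    fun j => aux_same P t ht.1 q j rfl
  have hqs : ∑ j, q j = 1 := hsum
  have hmem : t ∈ Set.Icc (0 : ℝ) 1 ∧
      ∑ j, phMed (fIM (k + 1)) (Fin.cons q P : Fin (k + 1) → Fin m → ℝ) t j = 1 :=
    ⟨ht, by simp only [hq, hqs]⟩
  obtain ⟨hs, hsum'⟩ := aux_tStar (Fin.cons q P : Fin (k + 1) → Fin m → ℝ) ⟨t, hmem⟩
  have hle : tStar (fIM (k + 1)) (Fin.cons q P : Fin (k + 1) → Fin m → ℝ) ≤ t :=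
    csInf_le ⟨0, fun t ht => ht.1.1⟩ hmem
  have hcoord : ∀ j ∈ (univ : Finset (Fin m)),
      phMed (fIM (k + 1)) (Fin.cons q P : Fin (k + 1) → Fin m → ℝ)
        (tStar (fIM (k + 1)) (Fin.cons q P : Fin (k + 1) → Fin m → ℝ)) j ≤ q j := by
    intro j _
    rw [← hq j]
    exact aux_mono _ _ _ hle j
  have := (Finset.sum_eq_sum_iff_of_le hcoord).1 (hsum'.trans hqs.symm)
  funext j
  exact this j (mem_univ j)
end
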